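/- arXiv:1507.06541 — 9 statements merged into one kernel-verified Lean document; each statement's English description precedes it below -/
import Mathlib

section
/- Let M be a dominating induced matching of a finite graph G. Then M contains at least one edge of every chordless odd cycle of G, and M contains exactly one edge of every chordless cycle of G of length 3, 5, or 7. -/
open SimpleGraph

/-- `M` is a dominating induced matching (d.i.m.) of `G`: every edge of `G` shares an
endpoint with exactly one edge of `M`. -/
def IsDIM {V : Type*} (G : SimpleGraph V) (M : Set (Sym2 V)) : Prop :=
  M ⊆ G.edgeSet ∧ ∀ e ∈ G.edgeSet, ∃! f, f ∈ M ∧ ∃ v, v ∈ e ∧ v ∈ f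

/-- `V(M)`: the set of endpoints of edges of `M`. -/
def MVerts {V : Type*} (M : Set (Sym2 V)) : Set V := {v | ∃ e ∈ M, v ∈ e}

/-- The distance level `N_i(xy) = {z | dist(z,{x,y}) = i}`. -/
def distLevel {V : Type*} (G : SimpleGraph V) (x y : V) (i : ℕ) : Set V :=
  {z : V | min (G.dist z x) (G.dist z y) = i}

/-- `c` lists the vertices of a chordless (induced) cycle of length `n` in `G`. -/
def IsInducedCycle {V : Type*} (G : SimpleGraph V) (n : ℕ) (c : ZMod n → V) : Prop :=
  Function.Injective c ∧ ∀ i j : ZMod n, G.Adj (c i) (c j) ↔ (j = i + 1 ∨ i = j + 1)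

/-- The diamond: vertices 0,1,2,3 and edges 01,02,12,13,23 (mid-edge 12). -/
def diamondGraph : SimpleGraph (Fin 4) :=
  SimpleGraph.fromEdgeSet {s(0,1), s(0,2), s(1,2), s(1,3), s(2,3)}

/-- The butterfly: vertices 0,1,2,3,4 and edges 01,02,12,23,24,34. -/
def butterflyGraph : SimpleGraph (Fin 5) :=
  SimpleGraph.fromEdgeSet {s(0,1), s(0,2), s(1,2), s(2,3), s(2,4), s(3,4)}

/-- The gem: a path 0-1-2-3 plus the universal vertex 4. -/
def gemGraph : SimpleGraph (Fin 5) :=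
  SimpleGraph.fromEdgeSet {s(0,1), s(1,2), s(2,3), s(4,0), s(4,1), s(4,2), s(4,3)}

/-- `T_w`: the vertices of `N_3(xy)` whose neighborhood in `N_2(xy)` is exactly `{w}`. -/
def Tset {V : Type*} (G : SimpleGraph V) (x y : V) (w : V) : Set V :=
  {t | t ∈ distLevel G x y 3 ∧ G.neighborSet t ∩ distLevel G x y 2 = {w}}

/-- The vertices distinct from and nonadjacent to both `t1` and `t2`
(the vertex set of `G'`). -/
def avoidSet {V : Type*} (G : SimpleGraph V) (t1 t2 : V) : Set V :=
  {v | v ≠ t1 ∧ v ≠ t2 ∧ ¬ G.Adj v t1 ∧ ¬ G.Adj v t2}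

theorem IsDIM.mem_or_mem_mVerts {V : Type*} {G : SimpleGraph V} {M : Set (Sym2 V)}
    (hM : IsDIM G M) {u v : V} (h : G.Adj u v) : u ∈ MVerts M ∨ v ∈ MVerts M := by
  obtain ⟨f, ⟨hf, w, hw, hwf⟩, -⟩ := hM.2 s(u, v) h
  rcases Sym2.mem_iff.1 hw with rfl | rfl
  exacts [Or.inl ⟨f, hf, hwf⟩, Or.inr ⟨f, hf, hwf⟩]

theorem IsDIM.mem_iff {V : Type*} {G : SimpleGraph V} {M : Set (Sym2 V)}
    (hM : IsDIM G M) {u v : V} (h : G.Adj u v) :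
    s(u, v) ∈ M ↔ u ∈ MVerts M ∧ v ∈ MVerts M := by
  refine ⟨fun he => ⟨⟨_, he, Sym2.mem_mk_left u v⟩, ⟨_, he, Sym2.mem_mk_right u v⟩⟩, ?_⟩
  rintro ⟨⟨e, he, hu⟩, ⟨f, hf, hv⟩⟩
  have hef : e = f := (hM.2 s(u, v) h).unique
    ⟨he, u, Sym2.mem_mk_left u v, hu⟩ ⟨hf, v, Sym2.mem_mk_right u v, hv⟩
  subst hef
  rwa [← (Sym2.mem_and_mem_iff h.ne).1 ⟨hu, hv⟩]

/-- Distinct edges of a d.i.m. share no endpoint. -/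
theorem IsDIM.eq_of_mem {V : Type*} {G : SimpleGraph V} {M : Set (Sym2 V)}
    (hM : IsDIM G M) {e f : Sym2 V} (he : e ∈ M) (hf : f ∈ M) {v : V}
    (hve : v ∈ e) (hvf : v ∈ f) : e = f :=
  (hM.2 e (hM.1 he)).unique ⟨he, v, hve, hve⟩ ⟨hf, v, hve, hvf⟩

theorem IsInducedCycle.adj_succ {V : Type*} {G : SimpleGraph V} {n : ℕ} {c : ZMod n → V}
    (hc : IsInducedCycle G n c) (i : ZMod n) : G.Adj (c i) (c (i + 1)) :=
  (hc.2 _ _).2 (Or.inl rfl)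

/-- A two-colouring of an odd cycle has two consecutive vertices of the same colour. -/
theorem exists_consecutive_iff_of_odd {n : ℕ} (hn : Odd n) (p : ZMod n → Prop) :
    ∃ i, p i ↔ p (i + 1) := by
  by_contra! h
  have key : ∀ k : ℕ, p k ↔ (Even k ↔ p 0) := by
    intro k
    induction k with
    | zero => simp
    | succ k ih =>
      have := h k
      rw [Nat.even_add_one]
      push_cast
      tauto
  have := key n
  rw [ZMod.natCast_self] at this
  have := Nat.not_even_iff_odd.2 hn
  tauto

/-- On a cycle of length 3, 5 or 7, if no two consecutive vertices are unmarked and no three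
consecutive vertices are marked, then at most one consecutive pair is marked. -/
theorem consecutive_pair_unique {n : ℕ} (hn : n = 3 ∨ n = 5 ∨ n = 7) (p : ZMod n → Prop)
    (h0 : ∀ i, p i ∨ p (i + 1)) (h1 : ∀ i, ¬ (p i ∧ p (i + 1) ∧ p (i + 1 + 1)))
    {i j : ZMod n} (hi : p i ∧ p (i + 1)) (hj : p j ∧ p (j + 1)) : j = i := by
  obtain ⟨d, rfl⟩ : ∃ d, j = i + d := ⟨j - i, by ring⟩
  have hd : d = 0 ∨ d = 1 ∨ d = 2 ∨ d = -1 ∨ d = -2 ∨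
      ((-2 : ZMod n) = 5 ∧ (d = 3 ∨ d = 4)) := by
    clear hj
    rcases hn with rfl | rfl | rfl <;> revert d <;> decide
  have hp2 : ¬ p (i + 2) := fun h => h1 i ⟨hi.1, hi.2, by convert h using 1; ring⟩
  have hp3 : p (i + 3) := by
    have := (h0 (i + 2)).resolve_left hp2
    convert this using 1; ring
  have hm1 : ¬ p (i + -1) := fun h => h1 (i + -1) ⟨h, by simpa using hi.1, by simpa using hi.2⟩
  have hm2 : p (i + -2) := by
    refine (h0 (i + -2)).resolve_right ?_
    convert hm1 using 2; ring
  rcases hd with rfl | rfl | rfl | rfl | rfl | ⟨h5, rfl | rfl⟩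
  · simp
  · exact absurd hj.2 (by convert hp2 using 2; ring)
  · exact absurd hj.1 hp2
  · exact absurd hj.1 hm1
  · exact absurd hj.2 (by convert hm1 using 2; ring)
  · rw [h5] at hm2
    exact absurd ⟨hj.1, hj.2, by convert hm2 using 1; ring⟩ (h1 (i + 3))
  · exact absurd ⟨hp3, by convert hj.1 using 1; ring, by convert hj.2 using 1; ring⟩ (h1 (i + 3))

/-- a d.i.m. contains at least one edge of every chordless odd cycle,
and exactly one edge of every chordless cycle of length 3, 5 or 7. -/
theorem stmt0 {V : Type*} [Fintype V] (G : SimpleGraph V) (M : Set (Sym2 V))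
    (hM : IsDIM G M) :
    (∀ (n : ℕ) (c : ZMod n → V), 3 ≤ n → Odd n → IsInducedCycle G n c →
      ∃ i : ZMod n, s(c i, c (i + 1)) ∈ M) ∧
    (∀ (n : ℕ) (c : ZMod n → V), (n = 3 ∨ n = 5 ∨ n = 7) → IsInducedCycle G n c →
      ∃! e : Sym2 V, e ∈ M ∧ ∃ i : ZMod n, e = s(c i, c (i + 1))) := by
  have exists_edge : ∀ (n : ℕ) (c : ZMod n → V), Odd n → IsInducedCycle G n c →
      ∃ i : ZMod n, s(c i, c (i + 1)) ∈ M := by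
    intro n c hn hc
    obtain ⟨i, hi⟩ := exists_consecutive_iff_of_odd hn (fun i => c i ∈ MVerts M)
    refine ⟨i, (hM.mem_iff (hc.adj_succ i)).2 ?_⟩
    have := hM.mem_or_mem_mVerts (hc.adj_succ i)
    tauto
  refine ⟨fun n c _ => exists_edge n c, fun n c hn hc => ?_⟩
  have hodd : Odd n := by rcases hn with rfl | rfl | rfl <;> decide
  obtain ⟨i, hi⟩ := exists_edge n c hodd hc
  refine ⟨_, ⟨hi, i, rfl⟩, ?_⟩
  rintro _ ⟨hj, j, rfl⟩
  suffices j = i by rw [this]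
  refine consecutive_pair_unique hn (fun k => c k ∈ MVerts M)
    (fun k => hM.mem_or_mem_mVerts (hc.adj_succ k)) ?_
    ((hM.mem_iff (hc.adj_succ i)).1 hi) ((hM.mem_iff (hc.adj_succ j)).1 hj)
  rintro k ⟨h1, h2, h3⟩
  have h := hM.eq_of_mem ((hM.mem_iff (hc.adj_succ k)).2 ⟨h1, h2⟩)
    ((hM.mem_iff (hc.adj_succ (k + 1))).2 ⟨h2, h3⟩)
    (Sym2.mem_mk_right _ _) (Sym2.mem_mk_left _ _)
  rw [Sym2.eq_swap, Sym2.congr_right] at h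
  have hk := hc.1 h
  clear h h1 h2 h3
  rcases hn with rfl | rfl | rfl <;> revert k <;> decide
end

section
/- Let M be a dominating induced matching of a finite graph G. Then every chordless cycle of length 6 of G contains either exactly two edges of M or no edge of M. -/
open SimpleGraph

/-- Two edges of a d.i.m. that both meet a given edge of the graph coincide. -/
theorem IsDIM.eq_of_adj {V : Type*} {G : SimpleGraph V} {M : Set (Sym2 V)} (hM : IsDIM G M)
    {u v : V} (huv : G.Adj u v) {e f : Sym2 V} (he : e ∈ M) (hf : f ∈ M)
    (hue : u ∈ e ∨ v ∈ e) (huf : u ∈ f ∨ v ∈ f) : e = f := by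
  refine (hM.2 s(u, v) huv).unique ⟨he, ?_⟩ ⟨hf, ?_⟩
  · rcases hue with h | h
    exacts [⟨u, by simp, h⟩, ⟨v, by simp, h⟩]
  · rcases huf with h | h
    exacts [⟨u, by simp, h⟩, ⟨v, by simp, h⟩]

/-- Every edge of the graph has an endpoint covered by a d.i.m. -/
theorem IsDIM.mem_mVerts_of_adj {V : Type*} {G : SimpleGraph V} {M : Set (Sym2 V)}
    (hM : IsDIM G M) {u v : V} (huv : G.Adj u v) : u ∈ MVerts M ∨ v ∈ MVerts M := by
  obtain ⟨f, ⟨hf, w, hw, hwf⟩, -⟩ := hM.2 s(u, v) huv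
  rcases Sym2.mem_iff.1 hw with rfl | rfl
  exacts [Or.inl ⟨f, hf, hwf⟩, Or.inr ⟨f, hf, hwf⟩]

/-- A neighbour of an endpoint of a matching edge, off that edge, is uncovered. -/
theorem IsDIM.notMem_mVerts {V : Type*} {G : SimpleGraph V} {M : Set (Sym2 V)}
    (hM : IsDIM G M) {u v w : V} (huv : s(u, v) ∈ M) (hvw : G.Adj v w) (hwu : w ≠ u) :
    w ∉ MVerts M := by
  rintro ⟨f, hf, hwf⟩
  obtain rfl := hM.eq_of_adj hvw huv hf (Or.inl (by simp)) (Or.inr hwf)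
  rcases Sym2.mem_iff.1 hwf with h | h
  exacts [hwu h, hvw.ne h.symm]

/-- An edge of the graph with both endpoints covered by a d.i.m. belongs to it. -/
theorem IsDIM.mem_of_mem_mVerts {V : Type*} {G : SimpleGraph V} {M : Set (Sym2 V)}
    (hM : IsDIM G M) {u v : V} (huv : G.Adj u v) (hu : u ∈ MVerts M) (hv : v ∈ MVerts M) :
    s(u, v) ∈ M := by
  obtain ⟨e, he, hue⟩ := hu
  obtain ⟨f, hf, hvf⟩ := hv
  obtain rfl := hM.eq_of_adj huv he hf (Or.inl hue) (Or.inr hvf)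
  rwa [← (Sym2.mem_and_mem_iff huv.ne).1 ⟨hue, hvf⟩]

/-- every chordless cycle of length 6 contains exactly two or
no edges of a d.i.m. `M`. -/
theorem stmt2 {V : Type*} [Fintype V] (G : SimpleGraph V) (M : Set (Sym2 V))
    (hM : IsDIM G M) (c : ZMod 6 → V) (hc : IsInducedCycle G 6 c) :
    {e : Sym2 V | e ∈ M ∧ ∃ i : ZMod 6, e = s(c i, c (i + 1))}.ncard = 0 ∨
    {e : Sym2 V | e ∈ M ∧ ∃ i : ZMod 6, e = s(c i, c (i + 1))}.ncard = 2 := by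
  obtain ⟨hinj, hadj⟩ := hc
  by_cases h : ∃ i, s(c i, c (i + 1)) ∈ M
  · right
    obtain ⟨i, hi⟩ := h
    have hne (a b : ZMod 6) (hab : a ≠ b) : c (i + a) ≠ c (i + b) := fun h =>
      hab (add_left_cancel (hinj h))
    have hnext (a b : ZMod 6) (hab : b = a + 1) : G.Adj (c (i + a)) (c (i + b)) :=
      (hadj _ _).2 (Or.inl (by rw [hab, add_assoc]))
    have h01 : s(c (i + 0), c (i + 1)) ∈ M := by rwa [add_zero]
    have h2 : c (i + 2) ∉ MVerts M :=
      hM.notMem_mVerts h01 (hnext 1 2 (by decide)) (hne 2 0 (by decide))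
    have h5 : c (i + 5) ∉ MVerts M :=
      hM.notMem_mVerts (Sym2.eq_swap ▸ h01) (hnext 5 0 (by decide)).symm (hne 5 1 (by decide))
    have h34 : s(c (i + 3), c (i + 4)) ∈ M :=
      hM.mem_of_mem_mVerts (hnext 3 4 (by decide))
        ((hM.mem_mVerts_of_adj (hnext 2 3 (by decide))).resolve_left h2)
        ((hM.mem_mVerts_of_adj (hnext 4 5 (by decide))).resolve_right h5)
    have hset : {e : Sym2 V | e ∈ M ∧ ∃ j : ZMod 6, e = s(c j, c (j + 1))} =
        {s(c (i + 0), c (i + 1)), s(c (i + 3), c (i + 4))} := by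
      ext e
      constructor
      · rintro ⟨he, j, rfl⟩
        obtain ⟨k, rfl⟩ : ∃ k, j = i + k := ⟨j - i, by ring⟩
        have hl : c (i + k) ∈ MVerts M := ⟨_, he, by simp⟩
        have hr : c (i + (k + 1)) ∈ MVerts M := ⟨_, he, by simp [add_assoc]⟩
        have hk : ∀ k : ZMod 6, k = 0 ∨ k = 3 ∨ k = 2 ∨ k = 5 ∨ k + 1 = 2 ∨ k + 1 = 5 := by
          decide
        rcases hk k with rfl | rfl | rfl | rfl | hk | hk
        · left
          rw [add_assoc, zero_add]
        · right
          rw [add_assoc]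
          rfl
        · exact absurd hl h2
        · exact absurd hl h5
        · exact absurd (hk ▸ hr) h2
        · exact absurd (hk ▸ hr) h5
      · rintro (rfl | rfl)
        · exact ⟨h01, i + 0, by rw [add_assoc, zero_add]⟩
        · exact ⟨h34, i + 3, by rw [add_assoc]; rfl⟩
    rw [hset, Set.ncard_pair]
    intro heq
    have hmem : c (i + 0) ∈ s(c (i + 3), c (i + 4)) := heq ▸ Sym2.mem_mk_left _ _
    rcases Sym2.mem_iff.1 hmem with h | h
    exacts [hne 0 3 (by decide) h, hne 0 4 (by decide) h]
  · left
    convert Set.ncard_empty (Sym2 V)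
    rw [Set.eq_empty_iff_forall_notMem]
    rintro e ⟨he, j, rfl⟩
    exact h ⟨j, he⟩
end

section
/- Let M be a dominating induced matching of a finite graph G. If vertices a,b,c,d induce a diamond in G with edges ab,ac,bc,bd,cd, then the mid-edge bc belongs to M; and if vertices a,b,c,d,e induce a butterfly in G with edges ab,ac,bc,cd,ce,de, then the peripheral edges ab and de both belong to M. -/
open SimpleGraph

namespace IsDIM

variable {V : Type*} {G : SimpleGraph V} {M : Set (Sym2 V)}

/-- Every edge has an endpoint covered by `M`. -/
theorem mem_mVerts_or (hM : IsDIM G M) {u v : V} (h : G.Adj u v) :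
    u ∈ MVerts M ∨ v ∈ MVerts M := by
  obtain ⟨f, ⟨hf, w, hw, hwf⟩, -⟩ := hM.2 s(u, v) h
  rcases Sym2.mem_iff.1 hw with rfl | rfl
  · exact Or.inl ⟨f, hf, hwf⟩
  · exact Or.inr ⟨f, hf, hwf⟩

/-- Two edges of `M` meeting the same edge of `G` coincide. -/
theorem eq_of_meets (hM : IsDIM G M) {u v x y : V} (h : G.Adj u v) {f g : Sym2 V}
    (hf : f ∈ M) (hg : g ∈ M) (hx : x = u ∨ x = v) (hy : y = u ∨ y = v)
    (hxf : x ∈ f) (hyg : y ∈ g) : f = g :=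
  (hM.2 s(u, v) h).unique ⟨hf, x, Sym2.mem_iff.2 hx, hxf⟩ ⟨hg, y, Sym2.mem_iff.2 hy, hyg⟩

/-- An edge with both endpoints covered by `M` belongs to `M`. -/
theorem mem_of_mVerts (hM : IsDIM G M) {u v : V} (h : G.Adj u v)
    (hu : u ∈ MVerts M) (hv : v ∈ MVerts M) : s(u, v) ∈ M := by
  obtain ⟨f, hf, huf⟩ := hu
  obtain ⟨g, hg, hvg⟩ := hv
  obtain rfl := hM.eq_of_meets h hf hg (.inl rfl) (.inr rfl) huf hvg
  rwa [← (Sym2.mem_and_mem_iff h.ne).1 ⟨huf, hvg⟩]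

/-- Two edges of `M` with a common endpoint have the same other endpoint. -/
theorem eq_of_mem_of_mem (hM : IsDIM G M) {u v w : V} (hv : s(u, v) ∈ M)
    (hw : s(u, w) ∈ M) : v = w :=
  Sym2.congr_right.1 <| hM.eq_of_meets (hM.1 hv) hv hw (.inl rfl) (.inl rfl)
    (Sym2.mem_mk_left _ _) (Sym2.mem_mk_left _ _)

/-- If a vertex of a triangle is not covered by `M`, then the opposite edge is in `M`. -/
theorem mem_of_notMem_mVerts (hM : IsDIM G M) {a b c : V} (hab : G.Adj a b)
    (hac : G.Adj a c) (hbc : G.Adj b c) (ha : a ∉ MVerts M) : s(b, c) ∈ M :=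
  hM.mem_of_mVerts hbc ((hM.mem_mVerts_or hab).resolve_left ha)
    ((hM.mem_mVerts_or hac).resolve_left ha)

/-- If a vertex of a triangle is covered by `M`, then `M` contains an edge of the triangle
at that vertex. -/
theorem mem_or_mem_of_mVerts (hM : IsDIM G M) {a b c : V} (hab : G.Adj a b)
    (hac : G.Adj a c) (hbc : G.Adj b c) (ha : a ∈ MVerts M) :
    s(a, b) ∈ M ∨ s(a, c) ∈ M :=
  (hM.mem_mVerts_or hbc).imp (hM.mem_of_mVerts hab ha) (hM.mem_of_mVerts hac ha)

end IsDIM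

/-- the mid-edge of any induced diamond and the two peripheral edges of any
induced butterfly belong to every d.i.m. -/
theorem stmt4 {V : Type*} [Fintype V] (G : SimpleGraph V) (M : Set (Sym2 V))
    (hM : IsDIM G M) :
    (∀ a b c d : V, a ≠ d →
      G.Adj a b → G.Adj a c → G.Adj b c → G.Adj b d → G.Adj c d → ¬ G.Adj a d →
      s(b, c) ∈ M) ∧
    (∀ a b c d e : V, a ≠ d → a ≠ e → b ≠ d → b ≠ e →
      G.Adj a b → G.Adj a c → G.Adj b c → G.Adj c d → G.Adj c e → G.Adj d e →
      ¬ G.Adj a d → ¬ G.Adj a e → ¬ G.Adj b d → ¬ G.Adj b e →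
      s(a, b) ∈ M ∧ s(d, e) ∈ M) := by
  refine ⟨fun a b c d had hab hac hbc hbd hcd _ => ?_,
    fun a b c d e had hae _ _ hab hac hbc hcd hce hde _ _ _ _ => ?_⟩
  · refine hM.mem_of_mVerts hbc ?_ ?_ <;> by_contra h
    · have h₁ := hM.mem_of_notMem_mVerts hab.symm hbc hac h
      have h₂ := hM.mem_of_notMem_mVerts hbc hbd hcd h
      exact had (hM.eq_of_mem_of_mem (Sym2.eq_swap ▸ h₁) h₂)
    · have h₁ := hM.mem_of_notMem_mVerts hac.symm hbc.symm hab h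
      have h₂ := hM.mem_of_notMem_mVerts hbc.symm hcd hbd h
      exact had (hM.eq_of_mem_of_mem (Sym2.eq_swap ▸ h₁) h₂)
  · have hc : c ∉ MVerts M := by
      intro hc
      rcases hM.mem_or_mem_of_mVerts hac.symm hbc.symm hab hc with h₁ | h₁ <;>
        rcases hM.mem_or_mem_of_mVerts hcd hce hde hc with h₂ | h₂ <;>
        have := hM.eq_of_mem_of_mem h₁ h₂ <;> contradiction
    exact ⟨hM.mem_of_notMem_mVerts hac.symm hbc.symm hab hc,
      hM.mem_of_notMem_mVerts hcd hce hde hc⟩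
end

section
/- Let G be a connected butterfly-free finite graph having a dominating induced matching M with |M| ≥ 2. Then there exist an edge uv ∈ M and a vertex r with ru ∈ E and rv ∉ E, i.e., some edge of M is contained in an induced P_3 of G. -/
open SimpleGraph

/-- Two edges of a d.i.m. that have equal or adjacent endpoints coincide. -/
theorem IsDIM.eq_of_eq_or_adj {V : Type*} {G : SimpleGraph V} {M : Set (Sym2 V)}
    (hM : IsDIM G M) {e f : Sym2 V} (he : e ∈ M) (hf : f ∈ M) {a b : V}
    (ha : a ∈ e) (hb : b ∈ f) (hab : a = b ∨ G.Adj a b) : e = f := by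
  rcases hab with rfl | hab
  · exact (hM.2 e (hM.1 he)).unique ⟨he, a, ha, ha⟩ ⟨hf, a, ha, hb⟩
  · exact (hM.2 s(a, b) hab).unique ⟨he, a, by simp, ha⟩ ⟨hf, b, by simp, hb⟩

/-- Two triangles sharing exactly one vertex, with no other edges between them,
form an induced butterfly. -/
theorem nonempty_butterflyGraph_embedding {V : Type*} {G : SimpleGraph V} {a b c d e : V}
    (hab : G.Adj a b) (hac : G.Adj a c) (hbc : G.Adj b c)
    (hcd : G.Adj c d) (hce : G.Adj c e) (hde : G.Adj d e)
    (had : a ≠ d ∧ ¬ G.Adj a d) (hae : a ≠ e ∧ ¬ G.Adj a e)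
    (hbd : b ≠ d ∧ ¬ G.Adj b d) (hbe : b ≠ e ∧ ¬ G.Adj b e) :
    Nonempty (butterflyGraph ↪g G) := by
  have := hab.ne
  have := hac.ne
  have := hbc.ne
  have := hcd.ne
  have := hce.ne
  have := hde.ne
  refine ⟨⟨⟨![a, b, c, d, e], ?_⟩, ?_⟩⟩
  · intro i j hij
    fin_cases i <;> fin_cases j <;> simp_all
  · intro i j
    change G.Adj (![a, b, c, d, e] i) (![a, b, c, d, e] j) ↔ _
    fin_cases i <;> fin_cases j <;> simp_all [butterflyGraph, G.adj_comm]

/-- in a connected butterfly-free graph with a d.i.m. `M` of at least two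
edges, some edge of `M` is contained in an induced P₃. -/
theorem stmt6 {V : Type*} [Fintype V] (G : SimpleGraph V) (hconn : G.Connected)
    (hBut : IsEmpty (butterflyGraph ↪g G))
    (M : Set (Sym2 V)) (hM : IsDIM G M) (hcard : 2 ≤ M.ncard) :
    ∃ u v r : V, s(u, v) ∈ M ∧ G.Adj r u ∧ r ≠ v ∧ ¬ G.Adj r v := by
  by_contra! H
  obtain ⟨e, f, he, hf, hef⟩ := (Set.one_lt_ncard_iff M.toFinite).1 hcard
  induction e with | _ u v
  have huv : G.Adj u v := hM.1 he
  have hvu : s(v, u) ∈ M := Sym2.eq_swap ▸ he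
  have closed : ∀ x y, G.Adj x y → (x = u ∨ G.Adj x u) → (y = u ∨ G.Adj y u) := by
    rintro x y hxy (rfl | hxu)
    · exact Or.inr hxy.symm
    by_contra! hy
    have hyv : ¬ G.Adj y v := fun h => hy.2 (H v u y hvu h hy.1)
    have hyv' : y ≠ v := by rintro rfl; exact hy.2 huv.symm
    have hxv : x ≠ v := by rintro rfl; exact hyv hxy.symm
    obtain ⟨g, ⟨hg, w, hw, hwg⟩, -⟩ := hM.2 s(x, y) hxy
    obtain ⟨t, rfl⟩ := hwg
    have hgne : s(u, v) ≠ s(w, t) := by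
      intro h
      have : w ∈ s(u, v) := h ▸ Sym2.mem_mk_left w t
      have := hxu.ne
      aesop
    rcases Sym2.mem_iff.1 hw with rfl | rfl
    · exact hgne (hM.eq_of_eq_or_adj he hg (by simp) (by simp) (Or.inr hxu.symm))
    have sep : ∀ a ∈ s(u, v), ∀ b ∈ s(w, t), a ≠ b ∧ ¬ G.Adj a b := fun a ha b hb =>
      not_or.1 fun h => hgne (hM.eq_of_eq_or_adj he hg ha hb h)
    have hxt : x ≠ t := by
      rintro rfl
      exact (sep u (by simp) x (by simp)).2 hxu.symm
    exact not_isEmpty_of_nonempty _ (h := nonempty_butterflyGraph_embedding huv hxu.symm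
      (H u v x he hxu hxv).symm hxy (H w t x hg hxy hxt) (hM.1 hg)
      (sep _ (by simp) _ (by simp)) (sep _ (by simp) _ (by simp))
      (sep _ (by simp) _ (by simp)) (sep _ (by simp) _ (by simp))) hBut
  have walk : ∀ x y, G.Walk x y → (y = u ∨ G.Adj y u) → (x = u ∨ G.Adj x u) := by
    intro x y p
    induction p with
    | nil => exact id
    | cons h _ ih => exact fun hy => closed _ _ h.symm (ih hy)
  have all : ∀ x, x = u ∨ G.Adj x u := fun x =>
    (hconn.preconnected x u).elim fun p => walk x u p (Or.inl rfl)
  induction f with | _ a b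
  exact hef (hM.eq_of_eq_or_adj he hf (by simp) (by simp)
    ((all a).imp Eq.symm SimpleGraph.Adj.symm))
end

section
/- Let G be a connected P_8-free finite graph, let M be a dominating induced matching of G with xy ∈ M, and suppose there is a vertex r with rx ∈ E and ry ∉ E. Then N_k(xy) = ∅ for every k ≥ 6. -/
open SimpleGraph

/-- A vertex sequence with the adjacencies of a chordless path on eight vertices gives an
embedding of `P₈`. -/
theorem nonempty_pathGraph_eight_embedding {V : Type*} (G : SimpleGraph V) (v : Fin 8 → V)
    (h : ∀ i j : Fin 8, i < j → (G.Adj (v i) (v j) ↔ i.val + 1 = j.val)) :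
    Nonempty (SimpleGraph.pathGraph 8 ↪g G) := by
  have key : ∀ i j : Fin 8, G.Adj (v i) (v j) ↔ (i.val + 1 = j.val ∨ j.val + 1 = i.val) := by
    intro i j
    rcases lt_trichotomy i j with hij | rfl | hij
    · rw [h i j hij]
      omega
    · simp
    · rw [G.adj_comm, h j i hij]
      omega
  have twin_free : ∀ i j : Fin 8,
      (∀ k : Fin 8, (i.val + 1 = k.val ∨ k.val + 1 = i.val) ↔
        (j.val + 1 = k.val ∨ k.val + 1 = j.val)) → i = j := by
    decide
  refine ⟨⟨⟨v, fun i j hij => twin_free i j fun k => ?_⟩, ?_⟩⟩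
  · rw [← key, ← key, hij]
  · intro i j
    rw [SimpleGraph.pathGraph_adj]
    exact key i j

/-- Eight vertices, consecutive ones adjacent and all other pairs nonadjacent, give an
embedding of `P₈`; the first five have levels `6, 5, 4, 3, 2` for a function that changes by
at most one along edges, and the last three have levels at most one. -/
theorem nonempty_pathGraph_eight_embedding_of_levels {V : Type*} (G : SimpleGraph V)
    (d : V → ℕ) (hd : ∀ a b, G.Adj a b → d a ≤ d b + 1) {u₆ u₅ u₄ u₃ u₂ p a b : V}
    (h₆ : d u₆ = 6) (h₅ : d u₅ = 5) (h₄ : d u₄ = 4) (h₃ : d u₃ = 3) (h₂ : d u₂ = 2)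
    (hp : d p ≤ 1) (ha : d a ≤ 1) (hb : d b ≤ 1)
    (h₆₅ : G.Adj u₆ u₅) (h₅₄ : G.Adj u₅ u₄) (h₄₃ : G.Adj u₄ u₃) (h₃₂ : G.Adj u₃ u₂)
    (h₂p : G.Adj u₂ p) (hpa : G.Adj p a) (hab : G.Adj a b)
    (h₂a : ¬ G.Adj u₂ a) (h₂b : ¬ G.Adj u₂ b) (hpb : ¬ G.Adj p b) :
    Nonempty (SimpleGraph.pathGraph 8 ↪g G) := by
  have far : ∀ s t, d t + 1 < d s → ¬ G.Adj s t := fun s t hst hadj => by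
    have := hd s t hadj
    omega
  refine nonempty_pathGraph_eight_embedding G ![u₆, u₅, u₄, u₃, u₂, p, a, b] ?_
  intro i j hij
  fin_cases i <;> fin_cases j <;>
    first
    | exact absurd hij (by decide)
    | simpa
    | simpa using far _ _ (by omega)

theorem eq_or_eq_of_min_dist_eq_zero {V : Type*} {G : SimpleGraph V} (hconn : G.Connected)
    {x y z : V} (hz : min (G.dist z x) (G.dist z y) = 0) : z = x ∨ z = y := by
  rcases Nat.min_eq_zero_iff.mp hz with h | h
  · exact Or.inl (hconn.dist_eq_zero_iff.mp h)
  · exact Or.inr (hconn.dist_eq_zero_iff.mp h)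

theorem min_dist_le_add_one {V : Type*} {G : SimpleGraph V} (hconn : G.Connected)
    (x y : V) {a b : V} (h : G.Adj a b) :
    min (G.dist a x) (G.dist a y) ≤ min (G.dist b x) (G.dist b y) + 1 := by
  have hx := hconn.dist_triangle (u := a) (v := b) (w := x)
  have hy := hconn.dist_triangle (u := a) (v := b) (w := y)
  rw [SimpleGraph.dist_eq_one_iff_adj.mpr h] at hx hy
  omega

theorem exists_adj_dist_eq {V : Type*} {G : SimpleGraph V} (hconn : G.Connected)
    {z x : V} {n : ℕ} (h : G.dist z x = n + 1) : ∃ w, G.Adj z w ∧ G.dist w x = n := by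
  obtain ⟨p, hp⟩ := hconn.exists_walk_length_eq_dist z x
  cases p with
  | nil => simp at h
  | @cons _ w _ hadj q =>
    refine ⟨w, hadj, ?_⟩
    have hq := SimpleGraph.dist_le q
    have ht := hconn.dist_triangle (u := z) (v := w) (w := x)
    rw [SimpleGraph.dist_eq_one_iff_adj.mpr hadj] at ht
    rw [SimpleGraph.Walk.length_cons] at hp
    omega

/-- Every vertex of a positive distance level has a neighbor in the previous level. -/
theorem exists_adj_mem_distLevel {V : Type*} {G : SimpleGraph V} (hconn : G.Connected)
    {x y z : V} {n : ℕ} (h : min (G.dist z x) (G.dist z y) = n + 1) :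
    ∃ w, G.Adj z w ∧ min (G.dist w x) (G.dist w y) = n := by
  have step : ∀ w, G.Adj z w → G.dist w x = n ∨ G.dist w y = n →
      min (G.dist w x) (G.dist w y) = n := by
    intro w hw hn
    have := min_dist_le_add_one hconn x y hw
    omega
  rcases min_choice (G.dist z x) (G.dist z y) with hc | hc
  · obtain ⟨w, hw, hn⟩ := exists_adj_dist_eq hconn (hc.symm.trans h)
    exact ⟨w, hw, step w hw (Or.inl hn)⟩
  · obtain ⟨w, hw, hn⟩ := exists_adj_dist_eq hconn (hc.symm.trans h)
    exact ⟨w, hw, step w hw (Or.inr hn)⟩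

/-- Two neighbors of an endpoint of an edge of a d.i.m., outside that edge, are nonadjacent. -/
theorem IsDIM.not_adj_of_adj {V : Type*} {G : SimpleGraph V} {M : Set (Sym2 V)}
    (hM : IsDIM G M) {x y a b : V} (hxy : s(x, y) ∈ M) (hax : G.Adj a x) (hbx : G.Adj b x)
    (hay : a ≠ y) (hby : b ≠ y) : ¬ G.Adj a b := by
  intro hab
  have not_covered : ∀ v, G.Adj v x → v ≠ y → ∀ f ∈ M, v ∉ f := by
    intro v hvx hvy f hf hvf
    have heq := (hM.2 s(v, x) hvx).unique ⟨hf, v, by simp, hvf⟩ ⟨hxy, x, by simp, by simp⟩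
    rw [heq, Sym2.mem_iff] at hvf
    exact hvf.elim hvx.ne hvy
  obtain ⟨f, ⟨hf, v, hv, hvf⟩, -⟩ := hM.2 s(a, b) hab
  rcases Sym2.mem_iff.mp hv with rfl | rfl
  · exact not_covered _ hax hay f hf hvf
  · exact not_covered _ hbx hby f hf hvf

/-- in a connected P₈-free graph with a d.i.m. `M`, `xy ∈ M`, and a vertex
`r` forming an induced P₃ `r-x-y`, all distance levels `N_k(xy)` with `k ≥ 6` are empty. -/
theorem stmt7 {V : Type*} [Fintype V] (G : SimpleGraph V) (hconn : G.Connected)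
    (hP8 : IsEmpty (SimpleGraph.pathGraph 8 ↪g G))
    (M : Set (Sym2 V)) (hM : IsDIM G M)
    (x y : V) (hxy : s(x, y) ∈ M)
    (r : V) (hrx : G.Adj r x) (hry : r ≠ y) (hrny : ¬ G.Adj r y) :
    ∀ k : ℕ, 6 ≤ k → distLevel G x y k = ∅ := by
  have hd := fun a b (h : G.Adj a b) => min_dist_le_add_one hconn x y h
  have hlevel_zero := fun z => eq_or_eq_of_min_dist_eq_zero hconn (x := x) (y := y) (z := z)
  have hlevel_succ := fun z n => exists_adj_mem_distLevel hconn (x := x) (y := y) (z := z) (n := n)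
  have hdx : min (G.dist x x) (G.dist x y) = 0 := by simp
  have hdy : min (G.dist y x) (G.dist y y) = 0 := by simp
  have hxy_adj : G.Adj x y := hM.1 hxy
  set d : V → ℕ := fun z => min (G.dist z x) (G.dist z y)
  change ∀ a b, G.Adj a b → d a ≤ d b + 1 at hd
  change ∀ z, d z = 0 → z = x ∨ z = y at hlevel_zero
  change ∀ z n, d z = n + 1 → ∃ w, G.Adj z w ∧ d w = n at hlevel_succ
  change d x = 0 at hdx
  change d y = 0 at hdy
  have hlevel_six : ∀ z, d z ≠ 6 := by
    intro u₆ h₆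
    obtain ⟨u₅, h₆₅, h₅⟩ := hlevel_succ u₆ 5 h₆
    obtain ⟨u₄, h₅₄, h₄⟩ := hlevel_succ u₅ 4 h₅
    obtain ⟨u₃, h₄₃, h₃⟩ := hlevel_succ u₄ 3 h₄
    obtain ⟨u₂, h₃₂, h₂⟩ := hlevel_succ u₃ 2 h₃
    obtain ⟨u₁, h₂₁, h₁⟩ := hlevel_succ u₂ 1 h₂
    obtain ⟨u₀, h₁₀, h₀⟩ := hlevel_succ u₁ 0 h₁
    have h₂x : ¬ G.Adj u₂ x := fun h => by have := hd _ _ h; omega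
    have h₂y : ¬ G.Adj u₂ y := fun h => by have := hd _ _ h; omega
    have hdr : d r ≤ 1 := by have := hd _ _ hrx; omega
    have h₁y : u₁ ≠ y := by rintro rfl; omega
    have no_path : ∀ {p a b : V}, d p ≤ 1 → d a ≤ 1 → d b ≤ 1 → G.Adj u₂ p → G.Adj p a →
        G.Adj a b → ¬ G.Adj u₂ a → ¬ G.Adj u₂ b → G.Adj p b := by
      intro p a b hp ha hb h₂p hpa hab h₂a h₂b
      by_contra hpb
      exact not_isEmpty_iff.mpr (nonempty_pathGraph_eight_embedding_of_levels G d hd h₆ h₅ h₄ h₃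
        h₂ hp ha hb h₆₅ h₅₄ h₄₃ h₃₂ h₂p hpa hab h₂a h₂b hpb) hP8
    have h₂r : ¬ G.Adj u₂ r := fun h =>
      hrny (no_path hdr (by omega) (by omega) h hrx hxy_adj h₂x h₂y)
    have h₁x : G.Adj u₁ x := by
      rcases hlevel_zero u₀ h₀ with rfl | rfl
      · exact h₁₀
      · exact no_path (by omega) (by omega) (by omega) h₂₁ h₁₀ hxy_adj.symm h₂y h₂x
    exact hM.not_adj_of_adj hxy h₁x hrx h₁y hry
      (no_path (by omega) (by omega) hdr h₂₁ h₁x hrx.symm h₂x h₂r)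
  have hlevel : ∀ k, 6 ≤ k → ∀ z, d z ≠ k := by
    intro k hk
    induction k, hk using Nat.le_induction with
    | base => exact hlevel_six
    | succ n _ ih =>
      intro z hz
      obtain ⟨w, -, hw⟩ := hlevel_succ z n hz
      exact ih w hw
  intro k hk
  exact Set.eq_empty_of_forall_notMem fun z hz => hlevel k hk z hz
end

section
/- Let M be a dominating induced matching of a finite graph G and let xy ∈ M. Then N_1(xy) is an independent set, and every vertex of N_2(xy) has at most one neighbor in N_2(xy); consequently the subgraph induced by N_2(xy) is the disjoint union of edges and isolated vertices. -/
open SimpleGraph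

namespace IsDIM

variable {V : Type*} {G : SimpleGraph V} {M : Set (Sym2 V)}

/-- Two matching edges meeting a common edge coincide. -/
theorem eq_of_adj_s8 (hM : IsDIM G M) {a b : V} (hab : G.Adj a b) {f g : Sym2 V}
    (hf : f ∈ M) (hg : g ∈ M) (hfa : a ∈ f) (hgb : b ∈ g) : f = g :=
  (hM.2 s(a, b) hab).unique ⟨hf, a, Sym2.mem_mk_left a b, hfa⟩
    ⟨hg, b, Sym2.mem_mk_right a b, hgb⟩

/-- Every edge has an endpoint covered by the matching. -/
theorem mem_mVerts_or_mem_mVerts (hM : IsDIM G M) {a b : V} (hab : G.Adj a b) :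
    a ∈ MVerts M ∨ b ∈ MVerts M := by
  obtain ⟨f, ⟨hf, v, hv, hvf⟩, -⟩ := hM.2 s(a, b) hab
  rcases Sym2.mem_iff.1 hv with rfl | rfl
  · exact Or.inl ⟨f, hf, hvf⟩
  · exact Or.inr ⟨f, hf, hvf⟩

/-- An edge between two covered vertices belongs to the matching. -/
theorem mk_mem_of_adj (hM : IsDIM G M) {a b : V} (hab : G.Adj a b)
    (ha : a ∈ MVerts M) (hb : b ∈ MVerts M) : s(a, b) ∈ M := by
  obtain ⟨f, hf, haf⟩ := ha
  obtain ⟨g, hg, hbg⟩ := hb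
  obtain rfl := hM.eq_of_adj_s8 hab hf hg haf hbg
  rwa [← (Sym2.mem_and_mem_iff hab.ne).1 ⟨haf, hbg⟩]

/-- A covered vertex has at most one covered neighbor. -/
theorem eq_of_adj_of_mem_mVerts (hM : IsDIM G M) {a b c : V} (hab : G.Adj a b)
    (hac : G.Adj a c) (ha : a ∈ MVerts M) (hb : b ∈ MVerts M) (hc : c ∈ MVerts M) : b = c := by
  have hf := hM.mk_mem_of_adj hac ha hc
  have hg := hM.mk_mem_of_adj hab ha hb
  exact (Sym2.congr_right.1 (hM.eq_of_adj_s8 hab hf hg (Sym2.mem_mk_left a c)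
    (Sym2.mem_mk_right a b))).symm

/-- A vertex outside a matching edge but adjacent to it is not covered. -/
theorem notMem_mVerts_s8 (hM : IsDIM G M) {e : Sym2 V} (he : e ∈ M) {a u : V} (hu : u ∈ e)
    (ha : a ∉ e) (hau : G.Adj a u) : a ∉ MVerts M := by
  rintro ⟨f, hf, haf⟩
  exact ha (hM.eq_of_adj_s8 hau hf he haf hu ▸ haf)

end IsDIM

section distLevel

variable {V : Type*} {G : SimpleGraph V} {x y a : V} {i : ℕ}

theorem notMem_mk_of_mem_distLevel (ha : a ∈ distLevel G x y i) (hi : i ≠ 0) :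
    a ∉ s(x, y) := by
  intro h
  rcases Sym2.mem_iff.1 h with rfl | rfl <;> simp_all [distLevel]

theorem exists_dist_eq_of_mem_distLevel (ha : a ∈ distLevel G x y i) :
    ∃ u ∈ s(x, y), G.dist a u = i := by
  rcases min_choice (G.dist a x) (G.dist a y) with h | h
  · exact ⟨x, Sym2.mem_mk_left x y, h ▸ ha⟩
  · exact ⟨y, Sym2.mem_mk_right x y, h ▸ ha⟩

theorem not_adj_of_mem_distLevel (ha : a ∈ distLevel G x y i) (hi : 2 ≤ i) {u : V}
    (hu : u ∈ s(x, y)) : ¬ G.Adj a u := by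
  intro h
  have h1 := dist_eq_one_iff_adj.2 h
  have ha' : min (G.dist a x) (G.dist a y) = i := ha
  rcases Sym2.mem_iff.1 hu with rfl | rfl <;> omega

end distLevel

section

variable {V : Type*} {G : SimpleGraph V} {M : Set (Sym2 V)} {x y a : V}

theorem IsDIM.notMem_mVerts_of_mem_distLevel_one (hM : IsDIM G M) (hxy : s(x, y) ∈ M)
    (ha : a ∈ distLevel G x y 1) : a ∉ MVerts M := by
  obtain ⟨u, hu, hau⟩ := exists_dist_eq_of_mem_distLevel ha
  exact hM.notMem_mVerts_s8 hxy hu (notMem_mk_of_mem_distLevel ha one_ne_zero)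
    (dist_eq_one_iff_adj.1 hau)

theorem IsDIM.mem_mVerts_of_mem_distLevel_two (hM : IsDIM G M) (hxy : s(x, y) ∈ M)
    (ha : a ∈ distLevel G x y 2) : a ∈ MVerts M := by
  obtain ⟨u, hu, hau⟩ := exists_dist_eq_of_mem_distLevel ha
  have hr : G.Reachable a u := .of_dist_ne_zero (hau.trans_ne two_ne_zero)
  obtain ⟨p, hp⟩ := hr.exists_walk_length_eq_dist
  rw [hau] at hp
  obtain ⟨w, haw, hwu⟩ : ∃ w, G.Adj a w ∧ G.Adj w u :=
    ⟨p.getVert 1, by simpa using p.adj_getVert_succ (i := 0) (by omega),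
      by simpa [← hp] using p.adj_getVert_succ (i := 1) (by omega)⟩
  refine (hM.mem_mVerts_or_mem_mVerts haw).resolve_right (hM.notMem_mVerts_s8 hxy hu ?_ hwu)
  exact fun hw => not_adj_of_mem_distLevel ha le_rfl hw haw

end

/-- for a d.i.m. `M` with `xy ∈ M`, `N₁(xy)` is independent and every vertex
of `N₂(xy)` has at most one neighbor in `N₂(xy)`. -/
theorem stmt8 {V : Type*} [Fintype V] (G : SimpleGraph V) (M : Set (Sym2 V))
    (hM : IsDIM G M) (x y : V) (hxy : s(x, y) ∈ M) :
    (∀ a ∈ distLevel G x y 1, ∀ b ∈ distLevel G x y 1, ¬ G.Adj a b) ∧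
    (∀ a ∈ distLevel G x y 2, ∀ b ∈ distLevel G x y 2, ∀ c ∈ distLevel G x y 2,
      G.Adj a b → G.Adj a c → b = c) := by
  refine ⟨fun a ha b hb hab => ?_, fun a ha b hb c hc hab hac => ?_⟩
  · exact (hM.mem_mVerts_or_mem_mVerts hab).elim
      (hM.notMem_mVerts_of_mem_distLevel_one hxy ha) (hM.notMem_mVerts_of_mem_distLevel_one hxy hb)
  · exact hM.eq_of_adj_of_mem_mVerts hab hac (hM.mem_mVerts_of_mem_distLevel_two hxy ha)
      (hM.mem_mVerts_of_mem_distLevel_two hxy hb) (hM.mem_mVerts_of_mem_distLevel_two hxy hc)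
end

section
/- Under the standing setup and with the sets T_i and S_3 as defined: (i) for every i ∈ {1,…,k}, T_i ∩ V(M) = {u'_i}; (ii) for every i, the subgraph induced by T_i contains at most one edge (T_i is the disjoint union of vertices and at most one edge); (iii) the subgraph induced by N_3 is bipartite; (iv) S_3 is an independent set and S_3 ∩ V(M) = ∅. -/
open SimpleGraph

theorem IsDIM.mem_of_adj {V : Type*} {G : SimpleGraph V} {M : Set (Sym2 V)} (hM : IsDIM G M)
    {a b : V} (hab : G.Adj a b) (ha : a ∈ MVerts M) (hb : b ∈ MVerts M) : s(a, b) ∈ M := by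
  obtain ⟨e, he, hae⟩ := ha
  obtain ⟨f, hf, hbf⟩ := hb
  have h := (hM.2 s(a, b) hab).unique ⟨he, a, by simp, hae⟩ ⟨hf, b, by simp, hbf⟩
  subst h
  rwa [← (Sym2.mem_and_mem_iff hab.ne).1 ⟨hae, hbf⟩]

theorem IsDIM.mem_or_mem {V : Type*} {G : SimpleGraph V} {M : Set (Sym2 V)} (hM : IsDIM G M)
    {a b : V} (hab : G.Adj a b) : a ∈ MVerts M ∨ b ∈ MVerts M := by
  obtain ⟨f, ⟨hf, v, hv, hvf⟩, -⟩ := hM.2 s(a, b) hab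
  rcases Sym2.mem_iff.1 hv with rfl | rfl
  exacts [Or.inl ⟨f, hf, hvf⟩, Or.inr ⟨f, hf, hvf⟩]

theorem IsDIM.mate_unique {V : Type*} {G : SimpleGraph V} {M : Set (Sym2 V)} (hM : IsDIM G M)
    {a b c : V} (hb : s(a, b) ∈ M) (hc : s(a, c) ∈ M) : b = c := by
  have h := (hM.2 s(a, b) (hM.1 hb)).unique
    ⟨hb, a, by simp, by simp⟩ ⟨hc, a, by simp, by simp⟩
  exact Sym2.congr_right.1 h

theorem exists_adj_distLevel {V : Type*} {G : SimpleGraph V} (hconn : G.Connected) {x y t : V}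
    {n : ℕ} (ht : t ∈ distLevel G x y (n + 1)) : ∃ w ∈ distLevel G x y n, G.Adj t w := by
  have step : ∀ z, G.dist t z = n + 1 → ∃ w, G.Adj t w ∧ G.dist w z ≤ n := by
    intro z hz
    obtain ⟨p, hp⟩ := hconn.exists_walk_length_eq_dist t z
    cases p with
    | nil => simp at hz
    | cons h q =>
      refine ⟨_, h, (SimpleGraph.dist_le q).trans ?_⟩
      simp only [SimpleGraph.Walk.length_cons] at hp
      omega
  have near : ∀ w, G.Adj t w → ∀ z, G.dist t z ≤ G.dist w z + 1 := by
    intro w hw z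
    have h := hconn.dist_triangle (u := t) (v := w) (w := z)
    rw [SimpleGraph.dist_eq_one_iff_adj.2 hw] at h
    omega
  simp only [distLevel, Set.mem_ofPred_eq] at ht ⊢
  obtain ⟨w, hw, hd⟩ : ∃ w, G.Adj t w ∧ (G.dist w x ≤ n ∨ G.dist w y ≤ n) := by
    rcases min_choice (G.dist t x) (G.dist t y) with h | h
    · obtain ⟨w, hw, hd⟩ := step x (h ▸ ht)
      exact ⟨w, hw, Or.inl hd⟩
    · obtain ⟨w, hw, hd⟩ := step y (h ▸ ht)
      exact ⟨w, hw, Or.inr hd⟩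
  have hx := near w hw x
  have hy := near w hw y
  exact ⟨w, by omega, hw⟩

theorem eq_or_adj_of_diamond_free {V : Type*} {G : SimpleGraph V}
    (hDia : IsEmpty (diamondGraph ↪g G)) {a b p q : V} (hpq : G.Adj p q) (hap : G.Adj a p)
    (haq : G.Adj a q) (hbp : G.Adj b p) (hbq : G.Adj b q) : a = b ∨ G.Adj a b := by
  by_contra! h
  obtain ⟨hab, hnab⟩ := h
  refine hDia.false ⟨⟨![a, p, q, b], ?_⟩, ?_⟩
  · intro i j
    fin_cases i <;> fin_cases j <;>
      simp [hab, hab.symm, hpq.ne, hpq.ne', hap.ne, hap.ne', haq.ne, haq.ne', hbp.ne, hbp.ne',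
        hbq.ne, hbq.ne']
  · intro i j
    change G.Adj (![a, p, q, b] i) (![a, p, q, b] j) ↔ diamondGraph.Adj i j
    fin_cases i <;> fin_cases j <;>
      simp [diamondGraph, hnab, mt SimpleGraph.Adj.symm hnab, hpq, hpq.symm, hap, hap.symm,
        haq, haq.symm, hbp, hbp.symm, hbq, hbq.symm]

/-- Lemma 1: (i) `T_i ∩ V(M) = {u'_i}`; (ii) each `T_i` contains at most
one edge; (iii) `G[N₃]` is bipartite; (iv) `S₃` is independent and disjoint from `V(M)`. -/
theorem stmt11 {V : Type*} [Fintype V] [DecidableEq V]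
    (G : SimpleGraph V) (hconn : G.Connected)
    (hP8 : IsEmpty (SimpleGraph.pathGraph 8 ↪g G))
    (hK4 : IsEmpty ((⊤ : SimpleGraph (Fin 4)) ↪g G))
    (hDia : IsEmpty (diamondGraph ↪g G))
    (hBut : IsEmpty (butterflyGraph ↪g G))
    (M : Set (Sym2 V)) (hM : IsDIM G M)
    (x y : V) (hxy : s(x, y) ∈ M)
    (r : V) (hrx : G.Adj r x) (hry : r ≠ y) (hrny : ¬ G.Adj r y)
    (hN2M : ∀ a b : V, a ∈ distLevel G x y 2 → b ∈ distLevel G x y 2 → s(a, b) ∉ M)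
    (k : ℕ) (u : Fin k → V) (huinj : Function.Injective u)
    (hurange : Set.range u = distLevel G x y 2)
    (u' : Fin k → V) (hu3 : ∀ i, u' i ∈ distLevel G x y 3)
    (huM : ∀ i, s(u i, u' i) ∈ M)
    :
    (∀ i : Fin k, Tset G x y (u i) ∩ MVerts M = {u' i}) ∧
    (∀ i : Fin k, ∀ a b c d : V, a ∈ Tset G x y (u i) → b ∈ Tset G x y (u i) →
      c ∈ Tset G x y (u i) → d ∈ Tset G x y (u i) →
      G.Adj a b → G.Adj c d → s(a, b) = s(c, d)) ∧
    (∃ C : Set V, ∀ a ∈ distLevel G x y 3, ∀ b ∈ distLevel G x y 3,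
      G.Adj a b → (a ∈ C ↔ b ∉ C)) ∧
    ((∀ a ∈ distLevel G x y 3 \ ⋃ i : Fin k, Tset G x y (u i),
      ∀ b ∈ distLevel G x y 3 \ ⋃ i : Fin k, Tset G x y (u i), ¬ G.Adj a b) ∧
     (distLevel G x y 3 \ ⋃ i : Fin k, Tset G x y (u i)) ∩ MVerts M = ∅) := by
  have hN2 : ∀ w ∈ distLevel G x y 2, ∃ i, u i = w := fun w hw => by rwa [← hurange] at hw
  have hu2 : ∀ i, u i ∈ distLevel G x y 2 := fun i => hurange ▸ Set.mem_range_self i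
  have huV : ∀ i, u i ∈ MVerts M := fun i => ⟨_, huM i, by simp⟩
  have hu'V : ∀ i, u' i ∈ MVerts M := fun i => ⟨_, huM i, by simp⟩
  have mate_eq : ∀ t ∈ MVerts M, ∀ i, G.Adj t (u i) → t = u' i := fun t ht i h =>
    hM.mate_unique (hM.mem_of_adj h.symm (huV i) ht) (huM i)
  have hT : ∀ i, u' i ∈ Tset G x y (u i) := by
    refine fun i => ⟨hu3 i, Set.eq_singleton_iff_unique_mem.2 ⟨⟨?_, hu2 i⟩, ?_⟩⟩
    · exact (show G.Adj (u i) (u' i) from hM.1 (huM i)).symm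
    · rintro w ⟨hw, hw2⟩
      obtain ⟨j, rfl⟩ := hN2 w hw2
      have hji : u' i = u' j := mate_eq _ (hu'V i) j hw
      exact hM.mate_unique (Sym2.eq_swap ▸ hji ▸ huM j) (Sym2.eq_swap ▸ huM i)
  have hTadj : ∀ i, ∀ t ∈ Tset G x y (u i), G.Adj t (u i) := fun i t ht =>
    (ht.2.symm ▸ Set.mem_singleton (u i) : u i ∈ G.neighborSet t ∩ distLevel G x y 2).1
  have hN3 : ∀ t ∈ distLevel G x y 3, t ∈ MVerts M → ∃ i, t = u' i := by
    intro t ht htM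
    obtain ⟨w, hw, htw⟩ := exists_adj_distLevel hconn ht
    obtain ⟨i, rfl⟩ := hN2 w hw
    exact ⟨i, mate_eq t htM i htw⟩
  have hS3 : ∀ t ∈ distLevel G x y 3 \ ⋃ i : Fin k, Tset G x y (u i), t ∉ MVerts M := by
    rintro t ⟨ht, hnt⟩ htM
    obtain ⟨i, rfl⟩ := hN3 t ht htM
    exact hnt (Set.mem_iUnion.2 ⟨i, hT i⟩)
  have hTe : ∀ i, ∀ a ∈ Tset G x y (u i), ∀ b ∈ Tset G x y (u i), G.Adj a b →
      ∃ c, G.Adj c (u i) ∧ G.Adj c (u' i) ∧ s(a, b) = s(u' i, c) := by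
    intro i a ha b hb hab
    rcases hM.mem_or_mem hab with h | h
    · obtain rfl := mate_eq a h i (hTadj i a ha)
      exact ⟨b, hTadj i b hb, hab.symm, rfl⟩
    · obtain rfl := mate_eq b h i (hTadj i b hb)
      exact ⟨a, hTadj i a ha, hab, Sym2.eq_swap⟩
  refine ⟨fun i => Set.eq_singleton_iff_unique_mem.2 ⟨⟨hT i, hu'V i⟩, fun t ht =>
    mate_eq t ht.2 i (hTadj i t ht.1)⟩, ?_, ⟨MVerts M, ?_⟩, ?_, ?_⟩
  · intro i a b c d ha hb hc hd hab hcd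
    obtain ⟨p, hp, hp', hpe⟩ := hTe i a ha b hb hab
    obtain ⟨q, hq, hq', hqe⟩ := hTe i c hc d hd hcd
    have not_mem : ∀ w, G.Adj w (u i) → G.Adj w (u' i) → w ∉ MVerts M := fun w hw hw' hwM =>
      hw'.ne (mate_eq w hwM i hw)
    rcases eq_or_adj_of_diamond_free hDia (hM.1 (huM i)) hp hp' hq hq' with rfl | h
    · rw [hpe, hqe]
    · exact ((hM.mem_or_mem h).elim (not_mem p hp hp') (not_mem q hq hq')).elim
  · refine fun a ha b hb hab => ⟨fun haM hbM => ?_, (hM.mem_or_mem hab).resolve_right⟩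
    obtain ⟨i, rfl⟩ := hN3 a ha haM
    have hbu : b = u i :=
      hM.mate_unique (hM.mem_of_adj hab haM hbM) (Sym2.eq_swap ▸ huM i)
    have h2 := hu2 i
    rw [← hbu] at h2
    simp only [distLevel, Set.mem_ofPred_eq] at hb h2
    omega
  · exact fun a ha b hb hab => (hM.mem_or_mem hab).elim (hS3 a ha) (hS3 b hb)
  · exact Set.eq_empty_of_forall_notMem fun t ht => hS3 t ht.1 ht.2
end

section
/- Under the standing setup and with the sets T_i as defined: if i ≠ j and a vertex t ∈ T_i is adjacent to two distinct vertices of T_j, then the edge u_i t belongs to M (i.e., t = u'_i). -/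
open SimpleGraph

/-- A matched vertex has no matched neighbour besides its mate. -/
theorem IsDIM.eq_mate_of_adj {V : Type*} {G : SimpleGraph V} {M : Set (Sym2 V)}
    (hM : IsDIM G M) {p q w : V} (hpq : s(p, q) ∈ M) (hw : G.Adj p w) (hwM : w ∈ MVerts M) :
    w = q := by
  obtain ⟨f, hf, hwf⟩ := hwM
  have hfpq : f = s(p, q) := (hM.2 s(p, w) hw).unique ⟨hf, w, by simp, hwf⟩ ⟨hpq, p, by simp⟩
  rw [hfpq, Sym2.mem_iff] at hwf
  exact hwf.resolve_left hw.ne'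

/-- An edge has at least one matched endpoint. -/
theorem IsDIM.mem_mVerts_or_of_adj {V : Type*} {G : SimpleGraph V} {M : Set (Sym2 V)}
    (hM : IsDIM G M) {p q : V} (hpq : G.Adj p q) : p ∈ MVerts M ∨ q ∈ MVerts M := by
  obtain ⟨f, ⟨hf, v, hv, hvf⟩, -⟩ := hM.2 s(p, q) hpq
  rcases Sym2.mem_iff.mp hv with rfl | rfl
  · exact Or.inl ⟨f, hf, hvf⟩
  · exact Or.inr ⟨f, hf, hvf⟩

theorem adj_of_mem_Tset {V : Type*} {G : SimpleGraph V} {x y w t : V}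
    (ht : t ∈ Tset G x y w) : G.Adj w t := by
  have h : w ∈ G.neighborSet t ∩ distLevel G x y 2 := ht.2 ▸ Set.mem_singleton w
  exact h.1.symm

/-- Lemma 1(v): if `t ∈ T_i` sees two distinct vertices of `T_j`
(`i ≠ j`), then `u_i t ∈ M`. -/
theorem stmt12 {V : Type*} [Fintype V] [DecidableEq V]
    (G : SimpleGraph V) (hconn : G.Connected)
    (hP8 : IsEmpty (SimpleGraph.pathGraph 8 ↪g G))
    (hK4 : IsEmpty ((⊤ : SimpleGraph (Fin 4)) ↪g G))
    (hDia : IsEmpty (diamondGraph ↪g G))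
    (hBut : IsEmpty (butterflyGraph ↪g G))
    (M : Set (Sym2 V)) (hM : IsDIM G M)
    (x y : V) (hxy : s(x, y) ∈ M)
    (r : V) (hrx : G.Adj r x) (hry : r ≠ y) (hrny : ¬ G.Adj r y)
    (hN2M : ∀ a b : V, a ∈ distLevel G x y 2 → b ∈ distLevel G x y 2 → s(a, b) ∉ M)
    (k : ℕ) (u : Fin k → V) (huinj : Function.Injective u)
    (hurange : Set.range u = distLevel G x y 2)
    (u' : Fin k → V) (hu3 : ∀ i, u' i ∈ distLevel G x y 3)
    (huM : ∀ i, s(u i, u' i) ∈ M)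
    :
    ∀ i j : Fin k, i ≠ j → ∀ t ∈ Tset G x y (u i), ∀ a ∈ Tset G x y (u j),
      ∀ b ∈ Tset G x y (u j), a ≠ b → G.Adj t a → G.Adj t b → s(u i, t) ∈ M := by
  intro i j _ t ht a ha b hb hab hta htb
  by_cases htM : t ∈ MVerts M
  · exact hM.eq_mate_of_adj (huM i) (adj_of_mem_Tset ht) htM ▸ huM i
  · have mate_of_adj {c : V} (hc : c ∈ Tset G x y (u j)) (htc : G.Adj t c) : c = u' j :=
      hM.eq_mate_of_adj (huM j) (adj_of_mem_Tset hc)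
        ((hM.mem_mVerts_or_of_adj htc).resolve_left htM)
    exact absurd ((mate_of_adj ha hta).trans (mate_of_adj hb htb).symm) hab
end

section
/- Under the standing setup with N_4 = ∅ and S_3 = ∅, assume that for all i ≠ j no vertex of T_i is adjacent to two distinct vertices of T_j, that there are adjacent vertices t_1 ∈ T_1 and t_2 ∈ T_2, and let G' be the subgraph of G induced by the vertices distinct from and nonadjacent to both t_1 and t_2. Let Z be the graph with vertex set {3,…,k} in which distinct i and j are adjacent if and only if some vertex of T_i ∩ V(G') is adjacent in G to some vertex of T_j ∩ V(G'). Then every connected component of Z is a single vertex or a star, i.e., each component with at least two vertices has a center vertex adjacent to all other vertices of the component and contains no edge between two non-center vertices. -/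
open SimpleGraph

/-- The auxiliary graph `Z` on the indices `i ∉ {i₁, i₂}`: distinct `i, j` are adjacent
iff some vertex of `T_i ∩ V(G')` is adjacent in `G` to some vertex of `T_j ∩ V(G')`. -/
def Zgraph {V : Type*} (G : SimpleGraph V) (x y : V) {k : ℕ} (u : Fin k → V)
    (i1 i2 : Fin k) (t1 t2 : V) :
    SimpleGraph {i : Fin k // i ≠ i1 ∧ i ≠ i2} :=
  SimpleGraph.fromRel fun i j =>
    ∃ a ∈ Tset G x y (u i.1) ∩ avoidSet G t1 t2,
      ∃ b ∈ Tset G x y (u j.1) ∩ avoidSet G t1 t2, G.Adj a b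

namespace SimpleGraph

variable {V : Type*} {G : SimpleGraph V}

/-- Eight vertices, consecutive ones adjacent and all other pairs nonadjacent, form an induced
path; distinctness is automatic. -/
theorem not_isEmpty_pathGraph_eight (f : Fin 8 → V)
    (hadj : ∀ i j : Fin 8, i.val + 1 = j.val → G.Adj (f i) (f j))
    (hnon : ∀ i j : Fin 8, i.val + 1 < j.val → ¬ G.Adj (f i) (f j)) :
    ¬ IsEmpty (pathGraph 8 ↪g G) := by
  have hlt : ∀ i j : Fin 8, i.val < j.val → f i ≠ f j := by
    intro i j hij heq
    rcases Nat.lt_or_ge (j.val + 1) 8 with h | h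
    · have h1 := hadj j ⟨j.val + 1, h⟩ rfl
      rw [← heq] at h1
      exact hnon i ⟨j.val + 1, h⟩ (by simpa using hij) h1
    · rcases Nat.eq_zero_or_pos i.val with h0 | h0
      · have h1 := hadj i 1 (by simp [h0])
        rw [heq] at h1
        exact hnon 1 j (show 1 + 1 < j.val by omega) h1.symm
      · have h1 := hadj ⟨i.val - 1, by omega⟩ i (show i.val - 1 + 1 = i.val by omega)
        rw [heq] at h1
        exact hnon ⟨i.val - 1, by omega⟩ j (show i.val - 1 + 1 < j.val by omega) h1
  have hinj : Function.Injective f := by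
    intro i j h
    by_contra hne
    rcases lt_or_gt_of_ne (fun hv => hne (Fin.ext hv)) with hij | hij
    · exact hlt i j hij h
    · exact hlt j i hij h.symm
  refine not_isEmpty_iff.mpr ⟨⟨⟨f, hinj⟩, ?_⟩⟩
  intro i j
  simp only [Function.Embedding.coeFn_mk, pathGraph_adj]
  constructor
  · intro h
    by_contra hcon
    rcases lt_trichotomy i.val j.val with hij | hij | hij
    · exact hnon i j (by omega) h
    · exact h.ne (congrArg f (Fin.ext hij))
    · exact hnon j i (by omega) h.symm
  · rintro (h | h)
    · exact hadj i j h
    · exact (hadj j i h).symm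

/-- Explicit list form of `not_isEmpty_pathGraph_eight`. -/
theorem false_of_induced_path_eight (hP8 : IsEmpty (pathGraph 8 ↪g G))
    (a b c d e f g h : V)
    (hadj : G.Adj a b ∧ G.Adj b c ∧ G.Adj c d ∧ G.Adj d e ∧ G.Adj e f ∧ G.Adj f g ∧ G.Adj g h)
    (ha : ¬ G.Adj a c ∧ ¬ G.Adj a d ∧ ¬ G.Adj a e ∧ ¬ G.Adj a f ∧ ¬ G.Adj a g ∧ ¬ G.Adj a h)
    (hb : ¬ G.Adj b d ∧ ¬ G.Adj b e ∧ ¬ G.Adj b f ∧ ¬ G.Adj b g ∧ ¬ G.Adj b h)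
    (hc : ¬ G.Adj c e ∧ ¬ G.Adj c f ∧ ¬ G.Adj c g ∧ ¬ G.Adj c h)
    (hd : ¬ G.Adj d f ∧ ¬ G.Adj d g ∧ ¬ G.Adj d h)
    (he : ¬ G.Adj e g ∧ ¬ G.Adj e h)
    (hf : ¬ G.Adj f h) : False := by
  refine not_isEmpty_pathGraph_eight ![a, b, c, d, e, f, g, h] ?_ ?_ hP8
  · intro i j hij
    fin_cases i <;> fin_cases j <;> simp at hij ⊢ <;> simp [hadj]
  · intro i j hij
    fin_cases i <;> fin_cases j <;> simp at hij ⊢ <;> simp [ha, hb, hc, hd, he, hf]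

/-- If all walks of length three backtrack, every connected component is a single vertex or a
star. -/
theorem ConnectedComponent.singleton_or_star {W : Type*} {H : SimpleGraph W}
    (hH : ∀ p q s w, H.Adj p q → H.Adj q s → H.Adj s w → p ≠ s → q ≠ w → False)
    (C : H.ConnectedComponent) :
    (∃ z, C.supp = {z}) ∨
      (∃ c ∈ C.supp, (∀ v ∈ C.supp, v ≠ c → H.Adj c v) ∧
        (∀ v ∈ C.supp, ∀ w ∈ C.supp, v ≠ c → w ≠ c → ¬ H.Adj v w)) := by
  induction C using ConnectedComponent.ind with | _ z
  by_cases hz : ∃ w, H.Adj z w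
  · right
    obtain ⟨w, hzw⟩ := hz
    obtain ⟨c, hcz, hc⟩ : ∃ c, H.Reachable c z ∧ ∀ v q, H.Adj c v → H.Adj v q → q = c := by
      by_cases hw : ∃ z', z' ≠ z ∧ H.Adj w z'
      · obtain ⟨z', hne, hwz'⟩ := hw
        refine ⟨w, hzw.symm.reachable, fun v q hv hq => ?_⟩
        by_contra hqw
        by_cases hvz : v = z
        · exact hH q v w z' hq.symm hv.symm hwz' hqw (by rw [hvz]; exact hne.symm)
        · exact hH q v w z hq.symm hv.symm hzw.symm hqw hvz
      · push Not at hw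
        refine ⟨z, Reachable.refl _, fun v q hv hq => ?_⟩
        by_contra hqz
        by_cases hvw : v = w
        · exact hw q hqz (hvw ▸ hq)
        · exact hH q v z w hq.symm hv.symm hzw hqz hvw
    have hreach : ∀ v, H.Reachable c v → v = c ∨ H.Adj c v := by
      rintro v hv
      rw [reachable_iff_reflTransGen] at hv
      induction hv with
      | refl => exact Or.inl rfl
      | tail _ hbq ih =>
        rcases ih with rfl | ih
        · exact Or.inr hbq
        · exact Or.inl (hc _ _ ih hbq)
    have hsupp : ∀ v ∈ (H.connectedComponentMk z).supp, v ≠ c → H.Adj c v := by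
      intro v hv hne
      have hvz : H.Reachable v z := ConnectedComponent.exact hv
      exact (hreach v (hcz.trans hvz.symm)).resolve_left hne
    refine ⟨c, ConnectedComponent.sound hcz, hsupp, ?_⟩
    intro v hv w _ hvc hwc hvw
    exact hwc (hc v w (hsupp v hv hvc) hvw)
  · left
    push Not at hz
    refine ⟨z, Set.ext fun v => ⟨fun hv => ?_, fun hv => hv ▸ rfl⟩⟩
    have hvz : H.Reachable z v := (ConnectedComponent.exact hv).symm
    rw [reachable_iff_reflTransGen] at hvz
    rcases hvz.cases_head with h | ⟨w, hzw, -⟩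
    · exact h.symm
    · exact (hz w hzw).elim

end SimpleGraph

section Levels

variable {V : Type*} {G : SimpleGraph V} {x y : V}

theorem distLevel_le_of_adj (hconn : G.Connected) {v w : V} {i j : ℕ}
    (hv : v ∈ distLevel G x y i) (hw : w ∈ distLevel G x y j) (h : G.Adj v w) :
    i ≤ j + 1 ∧ j ≤ i + 1 := by
  simp only [distLevel, Set.mem_ofPred_eq] at hv hw
  have h1 := hconn.dist_triangle (u := v) (v := w) (w := x)
  have h2 := hconn.dist_triangle (u := v) (v := w) (w := y)
  have h3 := hconn.dist_triangle (u := w) (v := v) (w := x)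
  have h4 := hconn.dist_triangle (u := w) (v := v) (w := y)
  have h5 : G.dist v w = 1 := dist_eq_one_iff_adj.mpr h
  have h6 : G.dist w v = 1 := dist_eq_one_iff_adj.mpr h.symm
  omega

theorem adj_or_adj_of_mem_distLevel_one {v : V} (hv : v ∈ distLevel G x y 1) :
    G.Adj v x ∨ G.Adj v y := by
  simp only [distLevel, Set.mem_ofPred_eq] at hv
  rw [← dist_eq_one_iff_adj, ← dist_eq_one_iff_adj]
  omega

theorem exists_adj_mem_distLevel_one (hconn : G.Connected) {v : V}
    (hv : v ∈ distLevel G x y 2) : ∃ n ∈ distLevel G x y 1, G.Adj v n := by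
  have key : ∀ z, (z = x ∨ z = y) → G.dist v z = 2 → ∃ n ∈ distLevel G x y 1, G.Adj v n := by
    intro z hz hd
    obtain ⟨p, hp⟩ := hconn.exists_walk_length_eq_dist v z
    rw [hd] at hp
    cases p with
    | nil => simp at hp
    | @cons _ n _ h q =>
      have hnz : G.dist n z ≤ 1 := (dist_le q).trans (by simpa using hp.le)
      refine ⟨n, ?_, h⟩
      have hle := (distLevel_le_of_adj hconn hv (rfl : n ∈ distLevel G x y _) h).1
      simp only [distLevel, Set.mem_ofPred_eq]
      rcases hz with rfl | rfl <;> omega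
  have hv' : min (G.dist v x) (G.dist v y) = 2 := hv
  rcases min_choice (G.dist v x) (G.dist v y) with h | h
  · exact key x (Or.inl rfl) (by omega)
  · exact key y (Or.inr rfl) (by omega)

theorem left_mem_distLevel_zero : x ∈ distLevel G x y 0 := by simp [distLevel]

theorem right_mem_distLevel_zero : y ∈ distLevel G x y 0 := by simp [distLevel]

theorem eq_of_mem_distLevel {v : V} {i j : ℕ} (hi : v ∈ distLevel G x y i)
    (hj : v ∈ distLevel G x y j) : i = j :=
  (show _ = i from hi).symm.trans hj

end Levels

section Matching

variable {V : Type*} {G : SimpleGraph V} {M : Set (Sym2 V)}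

theorem IsDIM.eq_of_adj_s15 (hM : IsDIM G M) {v w : V} {f g : Sym2 V} (h : G.Adj v w)
    (hf : f ∈ M) (hg : g ∈ M) (hvf : v ∈ f) (hwg : w ∈ g) : f = g :=
  (hM.2 s(v, w) h).unique ⟨hf, v, by simp, hvf⟩ ⟨hg, w, by simp, hwg⟩

theorem IsDIM.mem_or_mem_s15 (hM : IsDIM G M) {v w : V} (h : G.Adj v w) :
    v ∈ MVerts M ∨ w ∈ MVerts M := by
  obtain ⟨f, ⟨hf, z, hz, hzf⟩, -⟩ := hM.2 s(v, w) h
  rcases Sym2.mem_iff.mp hz with rfl | rfl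
  · exact Or.inl ⟨f, hf, hzf⟩
  · exact Or.inr ⟨f, hf, hzf⟩

end Matching

section Standing

variable {V : Type*} {G : SimpleGraph V} {M : Set (Sym2 V)} {x y : V}

theorem not_adj_of_mem_distLevel_one (hM : IsDIM G M)
    (hxy : s(x, y) ∈ M) {v w : V} (hv : v ∈ distLevel G x y 1) (hw : w ∈ distLevel G x y 1) :
    ¬ G.Adj v w := by
  have hnot : ∀ v ∈ distLevel G x y 1, v ∉ MVerts M := by
    rintro v hv ⟨f, hf, hvf⟩
    have hfe : f = s(x, y) := by
      rcases adj_or_adj_of_mem_distLevel_one hv with h | h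
      · exact hM.eq_of_adj_s15 h hf hxy hvf (by simp)
      · exact hM.eq_of_adj_s15 h hf hxy hvf (by simp)
    rw [hfe, Sym2.mem_iff] at hvf
    rcases hvf with rfl | rfl
    · exact absurd (eq_of_mem_distLevel hv left_mem_distLevel_zero) (by simp)
    · exact absurd (eq_of_mem_distLevel hv right_mem_distLevel_zero) (by simp)
  intro h
  exact (hM.mem_or_mem_s15 h).elim (hnot v hv) (hnot w hw)

variable {k : ℕ} {u u' : Fin k → V}

theorem mate_edge_injective (huinj : Function.Injective u)
    (hu2 : ∀ i, u i ∈ distLevel G x y 2) (hu3 : ∀ i, u' i ∈ distLevel G x y 3)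
    {i j : Fin k} (h : s(u i, u' i) = s(u j, u' j)) : i = j := by
  rcases Sym2.eq_iff.mp h with ⟨h, -⟩ | ⟨h, -⟩
  · exact huinj h
  · exact absurd (eq_of_mem_distLevel (h ▸ hu2 i) (hu3 j)) (by simp)

theorem Tset_adj {w t : V} (h : t ∈ Tset G x y w) : G.Adj t w := by
  have : w ∈ G.neighborSet t ∩ distLevel G x y 2 := h.2 ▸ rfl
  exact this.1

theorem Tset_not_adj {w w' t : V} (h : t ∈ Tset G x y w) (hw : w' ∈ distLevel G x y 2)
    (hne : w ≠ w') : ¬ G.Adj t w' := by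
  intro hadj
  have : w' ∈ G.neighborSet t ∩ distLevel G x y 2 := ⟨hadj, hw⟩
  rw [h.2] at this
  exact hne this.symm

theorem Tset_edge_mem_iff (hM : IsDIM G M) (huinj : Function.Injective u)
    (hu2 : ∀ i, u i ∈ distLevel G x y 2) (hu3 : ∀ i, u' i ∈ distLevel G x y 3)
    (huM : ∀ i, s(u i, u' i) ∈ M) {i j : Fin k} (hij : i ≠ j) {a b : V}
    (ha : a ∈ Tset G x y (u i)) (hb : b ∈ Tset G x y (u j)) (hab : G.Adj a b) :
    a ∈ MVerts M ↔ b ∉ MVerts M := by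
  refine ⟨?_, fun h => (hM.mem_or_mem_s15 hab).resolve_right h⟩
  rintro ⟨f, hf, haf⟩ ⟨g, hg, hbg⟩
  have hfi := hM.eq_of_adj_s15 (Tset_adj ha) hf (huM i) haf (by simp)
  have hgj := hM.eq_of_adj_s15 (Tset_adj hb) hg (huM j) hbg (by simp)
  have hfg := hM.eq_of_adj_s15 hab hf hg haf hbg
  exact hij (mate_edge_injective huinj hu2 hu3 (hfi.symm.trans (hfg.trans hgj)))

theorem not_adj_distLevel_two (hM : IsDIM G M) (huinj : Function.Injective u)
    (hu2 : ∀ i, u i ∈ distLevel G x y 2) (hu3 : ∀ i, u' i ∈ distLevel G x y 3)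
    (huM : ∀ i, s(u i, u' i) ∈ M) (i j : Fin k) : ¬ G.Adj (u i) (u j) := by
  intro h
  have := hM.eq_of_adj_s15 h (huM i) (huM j) (by simp) (by simp)
  exact h.ne (congrArg u (mate_edge_injective huinj hu2 hu3 this))

/-- If `t1 t2` is an edge between `T_{i1}` and `T_{i2}`, then `u_{i1}` has a common neighbor in
`N_1` with `u_i` for every other `i` such that `T_i` meets `G'`. -/
theorem exists_common_neighbor (hconn : G.Connected) (hP8 : IsEmpty (pathGraph 8 ↪g G))
    (hM : IsDIM G M) (hxy : s(x, y) ∈ M) (huinj : Function.Injective u)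
    (hu2 : ∀ i, u i ∈ distLevel G x y 2) (hu3 : ∀ i, u' i ∈ distLevel G x y 3)
    (huM : ∀ i, s(u i, u' i) ∈ M) {i1 i2 i : Fin k} (hi12 : i1 ≠ i2) (hi1 : i ≠ i1)
    (hi2 : i ≠ i2) {t1 t2 a : V} (ht1 : t1 ∈ Tset G x y (u i1)) (ht2 : t2 ∈ Tset G x y (u i2))
    (ht12 : G.Adj t1 t2) (ha : a ∈ Tset G x y (u i)) (haG : a ∈ avoidSet G t1 t2) :
    ∃ n ∈ distLevel G x y 1, G.Adj (u i1) n ∧ G.Adj n (u i) := by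
  obtain ⟨n, hn, hun⟩ := exists_adj_mem_distLevel_one hconn (hu2 i1)
  obtain ⟨m, hm, hum⟩ := exists_adj_mem_distLevel_one hconn (hu2 i)
  by_contra! hcon
  have hni := hcon n hn hun
  have hmi : ¬ G.Adj (u i1) m := fun h => hcon m hm h hum.symm
  have hnm := not_adj_of_mem_distLevel_one hM hxy hn hm
  have huu := not_adj_distLevel_two hM huinj hu2 hu3 huM
  have hfar : ∀ {p q : V} {c d : ℕ}, p ∈ distLevel G x y c → q ∈ distLevel G x y d →
      (c + 1 < d ∨ d + 1 < c) → ¬ G.Adj p q := by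
    intro p q c d hp hq hcd h
    have := distLevel_le_of_adj hconn hp hq h
    omega
  have htw : ∀ {t : V} {p q : Fin k}, t ∈ Tset G x y (u p) → p ≠ q → ¬ G.Adj t (u q) :=
    fun ht hpq => Tset_not_adj ht (hu2 _) (huinj.ne hpq)
  have same : ∀ z, z ∈ distLevel G x y 0 → G.Adj n z → G.Adj m z → False := by
    intro z hz hnz hmz
    refine false_of_induced_path_eight hP8 t2 t1 (u i1) n z m (u i) a
      ⟨ht12.symm, Tset_adj ht1, hun, hnz, hmz.symm, hum.symm, (Tset_adj ha).symm⟩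
      ⟨htw ht2 hi12.symm, hfar ht2.1 hn (by simp), hfar ht2.1 hz (by simp),
        hfar ht2.1 hm (by simp), htw ht2 hi2.symm, fun h => haG.2.2.2 h.symm⟩
      ⟨hfar ht1.1 hn (by simp), hfar ht1.1 hz (by simp),
        hfar ht1.1 hm (by simp), htw ht1 hi1.symm, fun h => haG.2.2.1 h.symm⟩
      ⟨hfar (hu2 _) hz (by simp), hmi, huu _ _, fun h => htw ha hi1 h.symm⟩
      ⟨hnm, hni, hfar hn ha.1 (by simp)⟩
      ⟨hfar hz (hu2 _) (by simp), hfar hz ha.1 (by simp)⟩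
      (hfar hm ha.1 (by simp))
  have diff : ∀ z z', z ∈ distLevel G x y 0 → z' ∈ distLevel G x y 0 → G.Adj z z' →
      G.Adj n z → G.Adj m z' → False := by
    intro z z' hz hz' hzz hnz hmz
    refine false_of_induced_path_eight hP8 t2 t1 (u i1) n z z' m (u i)
      ⟨ht12.symm, Tset_adj ht1, hun, hnz, hzz, hmz.symm, hum.symm⟩
      ⟨htw ht2 hi12.symm, hfar ht2.1 hn (by simp), hfar ht2.1 hz (by simp),
        hfar ht2.1 hz' (by simp), hfar ht2.1 hm (by simp), htw ht2 hi2.symm⟩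
      ⟨hfar ht1.1 hn (by simp), hfar ht1.1 hz (by simp), hfar ht1.1 hz' (by simp),
        hfar ht1.1 hm (by simp), htw ht1 hi1.symm⟩
      ⟨hfar (hu2 _) hz (by simp), hfar (hu2 _) hz' (by simp), hmi, huu _ _⟩
      ⟨fun h => same z' hz' h hmz, hnm, hni⟩
      ⟨fun h => same z hz hnz h.symm, hfar hz (hu2 _) (by simp)⟩
      (hfar hz' (hu2 _) (by simp))
  have hx := left_mem_distLevel_zero (G := G) (x := x) (y := y)
  have hy := right_mem_distLevel_zero (G := G) (x := x) (y := y)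
  have hxyG : G.Adj x y := hM.1 hxy
  rcases adj_or_adj_of_mem_distLevel_one hn with h | h <;>
    rcases adj_or_adj_of_mem_distLevel_one hm with h' | h'
  · exact same x hx h h'
  · exact diff x y hx hy hxyG h h'
  · exact diff y x hy hx hxyG.symm h h'
  · exact same y hy h h'

/-- A path `a b c` in the avoided set, with `a` in `T_i` and neither `b` nor `c` in `T_i`, has
`a` adjacent to `c`: otherwise it extends to an induced `P_8` through `t2, t1, u_{i1}`, a common
neighbor of `u_{i1}` and `u_i`, and `u_i`. -/
theorem adj_of_path_in_avoidSet (hconn : G.Connected) (hP8 : IsEmpty (pathGraph 8 ↪g G))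
    (hM : IsDIM G M) (hxy : s(x, y) ∈ M) (huinj : Function.Injective u)
    (hu2 : ∀ i, u i ∈ distLevel G x y 2) (hu3 : ∀ i, u' i ∈ distLevel G x y 3)
    (huM : ∀ i, s(u i, u' i) ∈ M) {i1 i2 : Fin k} (hi12 : i1 ≠ i2)
    {t1 t2 : V} (ht1 : t1 ∈ Tset G x y (u i1)) (ht2 : t2 ∈ Tset G x y (u i2))
    (ht12 : G.Adj t1 t2) {i j l : {i : Fin k // i ≠ i1 ∧ i ≠ i2}} {a b c : V}
    (hij : i ≠ j) (hil : i ≠ l)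
    (ha : a ∈ Tset G x y (u i.1) ∩ avoidSet G t1 t2)
    (hb : b ∈ Tset G x y (u j.1) ∩ avoidSet G t1 t2)
    (hc : c ∈ Tset G x y (u l.1) ∩ avoidSet G t1 t2)
    (hab : G.Adj a b) (hbc : G.Adj b c) : G.Adj a c := by
  by_contra hac
  obtain ⟨n, hn, hun, hnu⟩ := exists_common_neighbor hconn hP8 hM hxy huinj hu2 hu3 huM hi12
    i.2.1 i.2.2 ht1 ht2 ht12 ha.1 ha.2
  have hn3 : ∀ {p : V}, p ∈ distLevel G x y 3 → ¬ G.Adj n p := by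
    intro p hp h
    have := distLevel_le_of_adj hconn hn hp h
    omega
  have htw : ∀ {t : V} {p q : Fin k}, t ∈ Tset G x y (u p) → p ≠ q → ¬ G.Adj t (u q) :=
    fun ht hpq => Tset_not_adj ht (hu2 _) (huinj.ne hpq)
  have hij' : i.1 ≠ j.1 := fun h => hij (Subtype.ext h)
  have hil' : i.1 ≠ l.1 := fun h => hil (Subtype.ext h)
  refine false_of_induced_path_eight hP8 t2 t1 (u i1) n (u i) a b c
    ⟨ht12.symm, Tset_adj ht1, hun, hnu, (Tset_adj ha.1).symm, hab, hbc⟩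
    ⟨htw ht2 hi12.symm, fun h => hn3 ht2.1 h.symm, htw ht2 i.2.2.symm,
      fun h => ha.2.2.2.2 h.symm, fun h => hb.2.2.2.2 h.symm, fun h => hc.2.2.2.2 h.symm⟩
    ⟨fun h => hn3 ht1.1 h.symm, htw ht1 i.2.1.symm,
      fun h => ha.2.2.2.1 h.symm, fun h => hb.2.2.2.1 h.symm, fun h => hc.2.2.2.1 h.symm⟩
    ⟨not_adj_distLevel_two hM huinj hu2 hu3 huM _ _, fun h => htw ha.1 i.2.1 h.symm,
      fun h => htw hb.1 j.2.1 h.symm, fun h => htw hc.1 l.2.1 h.symm⟩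
    ⟨hn3 ha.1.1, hn3 hb.1.1, hn3 hc.1.1⟩
    ⟨fun h => htw hb.1 hij'.symm h.symm, fun h => htw hc.1 hil'.symm h.symm⟩
    hac

/-- Three consecutive edges of `Z` backtrack. -/
theorem Zgraph_walk_three_backtracks (hconn : G.Connected)
    (hP8 : IsEmpty (pathGraph 8 ↪g G))
    (hM : IsDIM G M) (hxy : s(x, y) ∈ M) (huinj : Function.Injective u)
    (hu2 : ∀ i, u i ∈ distLevel G x y 2) (hu3 : ∀ i, u' i ∈ distLevel G x y 3)
    (huM : ∀ i, s(u i, u' i) ∈ M) {i1 i2 : Fin k} (hi12 : i1 ≠ i2)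
    {t1 t2 : V} (ht1 : t1 ∈ Tset G x y (u i1)) (ht2 : t2 ∈ Tset G x y (u i2))
    (ht12 : G.Adj t1 t2) (i j l m : {i : Fin k // i ≠ i1 ∧ i ≠ i2})
    (hij : (Zgraph G x y u i1 i2 t1 t2).Adj i j) (hjl : (Zgraph G x y u i1 i2 t1 t2).Adj j l)
    (hlm : (Zgraph G x y u i1 i2 t1 t2).Adj l m) (hil : i ≠ l) (hjm : j ≠ m) : False := by
  have hZ : ∀ {p q}, (Zgraph G x y u i1 i2 t1 t2).Adj p q →
      ∃ a ∈ Tset G x y (u p.1) ∩ avoidSet G t1 t2,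
        ∃ b ∈ Tset G x y (u q.1) ∩ avoidSet G t1 t2, G.Adj a b := by
    rintro p q ⟨-, h | ⟨b, hb, a, ha, hba⟩⟩
    · exact h
    · exact ⟨a, ha, b, hb, hba.symm⟩
  -- a vertex of `G'` has neighbors in at most one other `T`-set
  have one : ∀ {i j l : {i : Fin k // i ≠ i1 ∧ i ≠ i2}} {a b d : V},
      a ∈ Tset G x y (u i.1) ∩ avoidSet G t1 t2 → b ∈ Tset G x y (u j.1) ∩ avoidSet G t1 t2 →
      d ∈ Tset G x y (u l.1) ∩ avoidSet G t1 t2 → i ≠ j → j ≠ l → i ≠ l →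
      G.Adj a b → ¬ G.Adj b d := by
    intro i j l a b d ha hb hd hij hjl hil hab hbd
    have had := adj_of_path_in_avoidSet hconn hP8 hM hxy huinj hu2 hu3 huM hi12 ht1 ht2 ht12
      hij hil ha hb hd hab hbd
    have h1 := Tset_edge_mem_iff hM huinj hu2 hu3 huM (Subtype.coe_injective.ne hij)
      ha.1 hb.1 hab
    have h2 := Tset_edge_mem_iff hM huinj hu2 hu3 huM (Subtype.coe_injective.ne hjl)
      hb.1 hd.1 hbd
    have h3 := Tset_edge_mem_iff hM huinj hu2 hu3 huM (Subtype.coe_injective.ne hil)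
      ha.1 hd.1 had
    tauto
  have two : ∀ {i j l : {i : Fin k // i ≠ i1 ∧ i ≠ i2}} {a b c d : V},
      a ∈ Tset G x y (u i.1) ∩ avoidSet G t1 t2 → b ∈ Tset G x y (u j.1) ∩ avoidSet G t1 t2 →
      c ∈ Tset G x y (u j.1) ∩ avoidSet G t1 t2 → d ∈ Tset G x y (u l.1) ∩ avoidSet G t1 t2 →
      i ≠ j → j ≠ l → i ≠ l → G.Adj a b → G.Adj c d → ¬ G.Adj b c := by
    intro i j l a b c d ha hb hc hd hij hjl hil hab hcd hbc
    have hac := adj_of_path_in_avoidSet hconn hP8 hM hxy huinj hu2 hu3 huM hi12 ht1 ht2 ht12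
      hij hij ha hb hc hab hbc
    exact one ha hc hd hij hjl hil hac hcd
  obtain ⟨a, ha, b, hb, hab⟩ := hZ hij
  obtain ⟨c, hc, d, hd, hcd⟩ := hZ hjl
  obtain ⟨e, he, f, hf, hef⟩ := hZ hlm
  have nij := hij.ne
  have njl := hjl.ne
  have nlm := hlm.ne
  have htw : ∀ {t : V} {p q : {i : Fin k // i ≠ i1 ∧ i ≠ i2}},
      t ∈ Tset G x y (u p.1) ∩ avoidSet G t1 t2 → p ≠ q → ¬ G.Adj t (u q.1) :=
    fun ht hpq => Tset_not_adj ht.1 (hu2 _) (huinj.ne (Subtype.coe_injective.ne hpq))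
  have haf : ¬ G.Adj a f := by
    by_cases him : i = m
    · subst him
      exact two hb ha hf he nij.symm hil njl hab.symm hef.symm
    · exact one hb ha hf nij.symm him hjm hab.symm
  have hbf : ¬ G.Adj b f := by
    by_cases him : i = m
    · subst him
      exact fun h => one hb hf he nij.symm hil njl h hef.symm
    · exact one ha hb hf nij hjm him hab
  exact false_of_induced_path_eight hP8 a b (u j.1) c d (u l.1) e f
    ⟨hab, Tset_adj hb.1, (Tset_adj hc.1).symm, hcd, Tset_adj hd.1, (Tset_adj he.1).symm, hef⟩
    ⟨htw ha nij, fun h => one ha hc hd nij njl hil h hcd, one hb ha hd nij.symm hil njl hab.symm,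
      htw ha hil, one hb ha he nij.symm hil njl hab.symm, haf⟩
    ⟨two ha hb hc hd nij njl hil hab hcd, one ha hb hd nij njl hil hab, htw hb njl,
      one ha hb he nij njl hil hab, hbf⟩
    ⟨fun h => htw hd njl.symm h.symm, not_adj_distLevel_two hM huinj hu2 hu3 huM _ _,
      fun h => htw he njl.symm h.symm, fun h => htw hf hjm.symm h.symm⟩
    ⟨htw hc njl, fun h => one hc he hf njl nlm hjm h hef,
      one hd hc hf njl.symm hjm nlm hcd.symm⟩
    ⟨two hc hd he hf njl nlm hjm hcd hef, one hc hd hf njl nlm hjm hcd⟩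
    (fun h => htw hf nlm.symm h.symm)

end Standing

/-- Lemma 5: every connected component of `Z` is a single vertex or a
star. -/
theorem stmt15 {V : Type*} [Fintype V] [DecidableEq V]
    (G : SimpleGraph V) (hconn : G.Connected)
    (hP8 : IsEmpty (SimpleGraph.pathGraph 8 ↪g G))
    (hK4 : IsEmpty ((⊤ : SimpleGraph (Fin 4)) ↪g G))
    (hDia : IsEmpty (diamondGraph ↪g G))
    (hBut : IsEmpty (butterflyGraph ↪g G))
    (M : Set (Sym2 V)) (hM : IsDIM G M)
    (x y : V) (hxy : s(x, y) ∈ M)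
    (r : V) (hrx : G.Adj r x) (hry : r ≠ y) (hrny : ¬ G.Adj r y)
    (hN2M : ∀ a b : V, a ∈ distLevel G x y 2 → b ∈ distLevel G x y 2 → s(a, b) ∉ M)
    (k : ℕ) (u : Fin k → V) (huinj : Function.Injective u)
    (hurange : Set.range u = distLevel G x y 2)
    (u' : Fin k → V) (hu3 : ∀ i, u' i ∈ distLevel G x y 3)
    (huM : ∀ i, s(u i, u' i) ∈ M)
    (hN4 : distLevel G x y 4 = ∅)
    (hS3 : distLevel G x y 3 \ ⋃ i : Fin k, Tset G x y (u i) = ∅)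
    (hno2 : ∀ i j : Fin k, i ≠ j → ∀ t ∈ Tset G x y (u i), ∀ a ∈ Tset G x y (u j),
      ∀ b ∈ Tset G x y (u j), G.Adj t a → G.Adj t b → a = b)
    (i1 i2 : Fin k) (hi12 : i1 ≠ i2)
    (t1 t2 : V) (ht1 : t1 ∈ Tset G x y (u i1)) (ht2 : t2 ∈ Tset G x y (u i2))
    (ht12 : G.Adj t1 t2) :
    ∀ C : (Zgraph G x y u i1 i2 t1 t2).ConnectedComponent,
      (∃ z, C.supp = {z}) ∨
      (∃ c ∈ C.supp,
        (∀ v ∈ C.supp, v ≠ c → (Zgraph G x y u i1 i2 t1 t2).Adj c v) ∧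
        (∀ v ∈ C.supp, ∀ w ∈ C.supp, v ≠ c → w ≠ c →
          ¬ (Zgraph G x y u i1 i2 t1 t2).Adj v w)) := by
  have hu2 : ∀ i, u i ∈ distLevel G x y 2 := fun i => hurange ▸ Set.mem_range_self i
  exact ConnectedComponent.singleton_or_star
    (Zgraph_walk_three_backtracks hconn hP8 hM hxy huinj hu2 hu3 huM hi12 ht1 ht2 ht12)
end
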